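/- arXiv:2307.07152 — 5 statements merged into one kernel-verified Lean document; each statement's English description precedes it below -/
import Mathlib

section
/- Let λ > 1 be a real number, w ∈ ℂ, and k a natural number. With F_{w,k}(z) = Σ_{n=0}^∞ (wⁿ/n!) · √(Γ(n+λ)/(n!·Γ(λ))) · z^{n+k}, one has ((λ-1)/π) · ∫_{𝔻} |F_{w,k}(z)|² (1-|z|²)^{λ-2} dA(z) = I_{k,λ}(|w|²), where I_{k,λ}(t) = Σ_{n=0}^∞ (tⁿ/(n!)²) · ((n+k)!/n!) · (Γ(n+λ)/Γ(n+k+λ)). In particular F_{w,k} belongs to the weighted Bergman space ℋ_λ, and c·F_{w,k} has unit norm in ℋ_λ exactly when |c|² · I_{k,λ}(|w|²) = 1. -/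
open MeasureTheory

lemma aux_beta (lam : ℝ) (hlam : 1 < lam) (m : ℕ) :
    ∫ t in Set.Ioo (0:ℝ) 1, t ^ m * (1 - t) ^ (lam - 2) =
      m.factorial * Real.Gamma (lam - 1) / Real.Gamma (m + lam) := by
  have h := Complex.betaIntegral_eq_Gamma_mul_div ((m + 1 : ℝ) : ℂ) ((lam - 1 : ℝ) : ℂ)
    (by rw [Complex.ofReal_re]; positivity) (by rw [Complex.ofReal_re]; linarith)
  rw [← Complex.ofReal_add, Complex.Gamma_ofReal, Complex.Gamma_ofReal, Complex.Gamma_ofReal,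
    Complex.betaIntegral, intervalIntegral.integral_of_le zero_le_one,
    integral_Ioc_eq_integral_Ioo,
    setIntegral_congr_fun (g := fun t : ℝ => ((t ^ m * (1 - t) ^ (lam - 2) : ℝ) : ℂ))
      measurableSet_Ioo] at h
  · rw [integral_complex_ofReal] at h
    have h2 : (m + 1 : ℝ) + (lam - 1) = m + lam := by ring
    rw [h2, Real.Gamma_nat_eq_factorial] at h
    exact_mod_cast h
  · intro t ht
    have h1 : (0:ℝ) ≤ 1 - t := by linarith [ht.2]
    simp only
    rw [Complex.ofReal_mul, Complex.ofReal_cpow h1, Complex.ofReal_pow]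
    congr 1
    · rw [← Complex.cpow_natCast]
      congr 1
      push_cast; ring
    · push_cast
      congr 1
      ring

lemma aux_rad (lam : ℝ) (hlam : 1 < lam) (m : ℕ) :
    ∫ z in Metric.ball (0 : ℂ) 1, (‖z‖ ^ 2) ^ m * (1 - ‖z‖ ^ 2) ^ (lam - 2) =
      Real.pi * (m.factorial * Real.Gamma (lam - 1) / Real.Gamma (m + lam)) := by
  set g : ℝ → ℝ := (Set.Iio 1).indicator (fun t => t ^ m * (1 - t) ^ (lam - 2)) with hg
  have h1 : ∫ z in Metric.ball (0 : ℂ) 1, (‖z‖ ^ 2) ^ m * (1 - ‖z‖ ^ 2) ^ (lam - 2) =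
      ∫ z : ℂ, (fun r : ℝ => g (r ^ 2)) ‖z‖ := by
    rw [← integral_indicator measurableSet_ball]
    congr 1
    ext z
    simp only [hg, Set.indicator, Metric.mem_ball, dist_zero_right, Set.mem_Iio]
    have : ‖z‖ < 1 ↔ ‖z‖ ^ 2 < 1 := by
      rw [sq_lt_one_iff₀ (norm_nonneg z)]
    simp only [this]
  have h2 := integral_comp_rpow_Ioi_of_pos (g := g) (p := 2) (by norm_num)
  have h3 : ∫ y in Set.Ioi 0, g y = ∫ t in Set.Ioo (0:ℝ) 1, t ^ m * (1 - t) ^ (lam - 2) := by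
    rw [hg, setIntegral_indicator measurableSet_Iio]
    rfl
  have h4 : ∫ x in Set.Ioi (0:ℝ), ((2:ℝ) * x ^ ((2:ℝ) - 1)) • g (x ^ (2:ℝ)) =
      2 * ∫ x in Set.Ioi (0:ℝ), x ^ (2 - 1) • g (x ^ 2) := by
    rw [← integral_const_mul]
    congr 1
    ext x
    norm_num
    ring
  rw [h1, integral_fun_norm_addHaar volume (fun r : ℝ => g (r ^ 2)), Complex.finrank_real_complex,
    ← aux_beta lam hlam m, ← h3, ← h2, h4, measureReal_def, Complex.volume_ball]
  simp
  ring

lemma aux_int (lam : ℝ) (hlam : 1 < lam) :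
    IntegrableOn (fun z : ℂ => (1 - ‖z‖ ^ 2) ^ (lam - 2)) (Metric.ball (0 : ℂ) 1) volume := by
  have h := aux_rad lam hlam 0
  simp only [pow_zero, one_mul] at h
  apply Integrable.of_integral_ne_zero
  rw [h]
  have h1 := Real.Gamma_pos_of_pos (show 0 < lam - 1 by linarith)
  have h2 := Real.Gamma_pos_of_pos (show 0 < ((0:ℕ):ℝ) + lam by push_cast; linarith)
  have := Real.pi_pos
  positivity

lemma aux_orth (s : ℝ) (n m : ℕ) (h : n ≠ m) :
    ∫ z in Metric.ball (0 : ℂ) 1, z ^ n * (starRingEnd ℂ z) ^ m * (((1 - ‖z‖ ^ 2) ^ s : ℝ) : ℂ)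
      = 0 := by
  set G : ℂ → ℂ := (Metric.ball (0 : ℂ) 1).indicator
    (fun z => z ^ n * (starRingEnd ℂ z) ^ m * (((1 - ‖z‖ ^ 2) ^ s : ℝ) : ℂ)) with hG
  rw [← integral_indicator measurableSet_ball, ← hG]
  set u : Circle := Circle.exp (Real.pi / ((n:ℝ) - m)) with hu
  have hnm : (n : ℂ) - m ≠ 0 := by
    rw [sub_ne_zero]; exact_mod_cast h
  have hu1 : (u:ℂ) ^ n * (starRingEnd ℂ (u:ℂ)) ^ m = -1 := by
    rw [hu, Circle.coe_exp, ← Complex.exp_conj, ← Complex.exp_nat_mul, ← Complex.exp_nat_mul,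
      ← Complex.exp_add, ← Complex.exp_pi_mul_I]
    congr 1
    simp only [map_mul, Complex.conj_ofReal, Complex.conj_I]
    push_cast
    field_simp
    ring
  have h1 : ∫ z, G (rotation u z) = ∫ z, G z :=
    (rotation u).measurePreserving.integral_comp
      (rotation u).toHomeomorph.measurableEmbedding G
  have h2 : ∀ z, G (rotation u z) = - G z := by
    intro z
    have hn : ‖(u:ℂ) * z‖ = ‖z‖ := by rw [norm_mul, Circle.norm_coe, one_mul]
    simp only [hG, Set.indicator, rotation_apply, Metric.mem_ball, dist_zero_right, hn]
    split_ifs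
    · rw [map_mul, mul_pow, mul_pow]
      linear_combination (z ^ n * (starRingEnd ℂ z) ^ m * (((1 - ‖z‖ ^ 2) ^ s : ℝ) : ℂ)) * hu1
    · simp
  simp only [h2, integral_neg] at h1
  have h3 : (2:ℂ) * ∫ z, G z = 0 := by linear_combination -h1
  simpa using h3

lemma aux_coef (lam : ℝ) (hlam : 1 < lam) (n : ℕ) :
    Real.Gamma ((n : ℝ) + lam) / ((n.factorial : ℝ) * Real.Gamma lam) ≤ lam ^ n := by
  have hG := Real.Gamma_pos_of_pos (show 0 < lam by linarith)
  induction n with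
  | zero => simp [hG.ne']
  | succ n ih =>
    have h0 : (n:ℝ) + lam ≠ 0 := by positivity
    have e : ((n+1:ℕ):ℝ) + lam = (n + lam) + 1 := by push_cast; ring
    rw [e, Real.Gamma_add_one h0, Nat.factorial_succ, pow_succ]
    have h2 : ((n:ℝ) + lam) / (n + 1) ≤ lam := by
      rw [div_le_iff₀ (by positivity)]
      nlinarith [(Nat.cast_nonneg n : (0:ℝ) ≤ n)]
    calc _ = Real.Gamma ((n : ℝ) + lam) / ((n.factorial : ℝ) * Real.Gamma lam) *
          (((n:ℝ) + lam) / (n + 1)) := by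
          push_cast; field_simp
      _ ≤ _ := by
          apply mul_le_mul ih h2 (by positivity) (by positivity)

lemma aux_main (lam : ℝ) (hlam : 1 < lam) (k : ℕ) (a : ℕ → ℂ) (ha : Summable fun n => ‖a n‖)
    (F : ℂ → ℂ) (hF : ∀ z, F z = ∑' n, a n * z ^ (n + k)) :
    IntegrableOn (fun z : ℂ => ‖F z‖ ^ 2 * (1 - ‖z‖ ^ 2) ^ (lam - 2))
      (Metric.ball (0 : ℂ) 1) volume ∧
    ∫ z in Metric.ball (0 : ℂ) 1, ‖F z‖ ^ 2 * (1 - ‖z‖ ^ 2) ^ (lam - 2) =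
      ∑' n : ℕ, ‖a n‖ ^ 2 * (Real.pi * ((n + k).factorial * Real.Gamma (lam - 1) /
        Real.Gamma ((n + k : ℕ) + lam))) := by
  have hW := aux_int lam hlam
  have hWpos : ∀ z ∈ Metric.ball (0:ℂ) 1, 0 ≤ (1 - ‖z‖ ^ 2) ^ (lam - 2) := by
    intro z hz
    rw [mem_ball_zero_iff] at hz
    apply Real.rpow_nonneg
    nlinarith [norm_nonneg z]
  have hpw : ∀ z ∈ Metric.ball (0:ℂ) 1, ∀ n, ‖z ^ n‖ ≤ 1 := by
    intro z hz n
    rw [mem_ball_zero_iff] at hz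
    rw [norm_pow]
    exact pow_le_one₀ (norm_nonneg z) hz.le
  have hb : ∀ n, ∀ z ∈ Metric.ball (0:ℂ) 1, ‖a n * z ^ (n + k)‖ ≤ ‖a n‖ := by
    intro n z hz
    rw [norm_mul]
    exact mul_le_of_le_one_right (norm_nonneg _) (hpw z hz _)
  have hFc : ContinuousOn F (Metric.ball (0:ℂ) 1) := by
    rw [show F = fun z => ∑' n, a n * z ^ (n + k) from funext hF]
    exact continuousOn_tsum (fun n => by fun_prop) ha hb
  have hFb : ∀ z ∈ Metric.ball (0:ℂ) 1, ‖F z‖ ≤ ∑' n, ‖a n‖ := by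
    intro z hz
    rw [hF]
    exact tsum_of_norm_bounded ha.hasSum (fun n => hb n z hz)
  have hmeasF : AEStronglyMeasurable (fun z => ‖F z‖ ^ 2)
      (volume.restrict (Metric.ball (0:ℂ) 1)) :=
    (hFc.norm.pow 2).aestronglyMeasurable measurableSet_ball
  constructor
  · refine Integrable.bdd_mul (c := (∑' n, ‖a n‖) ^ 2) hW hmeasF ?_
    filter_upwards [ae_restrict_mem measurableSet_ball] with z hz
    rw [norm_pow, norm_norm]
    gcongr
    exact hFb z hz
  · set T : ℕ × ℕ → ℂ → ℂ := fun p z => (a p.1 * starRingEnd ℂ (a p.2)) *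
      (z ^ (p.1 + k) * (starRingEnd ℂ z) ^ (p.2 + k) * (((1 - ‖z‖ ^ 2) ^ (lam - 2) : ℝ) : ℂ))
      with hT
    have hTn : ∀ p, ∀ z ∈ Metric.ball (0:ℂ) 1,
        ‖T p z‖ ≤ ‖a p.1‖ * ‖a p.2‖ * (1 - ‖z‖ ^ 2) ^ (lam - 2) := by
      intro p z hz
      simp only [hT]
      have e : (starRingEnd ℂ z) ^ (p.2 + k) = starRingEnd ℂ (z ^ (p.2 + k)) := by rw [map_pow]
      rw [e, norm_mul, norm_mul, norm_mul, norm_mul, Complex.norm_conj, Complex.norm_conj,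
        Complex.norm_real, Real.norm_of_nonneg (hWpos z hz)]
      apply mul_le_mul_of_nonneg_left _ (by positivity)
      apply mul_le_of_le_one_left (hWpos z hz)
      exact mul_le_one₀ (hpw z hz _) (norm_nonneg _) (hpw z hz _)
    have hTi : ∀ p, IntegrableOn (T p) (Metric.ball (0:ℂ) 1) volume := by
      intro p
      refine Integrable.mono' (hW.const_mul (‖a p.1‖ * ‖a p.2‖)) ?_ ?_
      · apply Measurable.aestronglyMeasurable
        simp only [hT]
        fun_prop
      · filter_upwards [ae_restrict_mem measurableSet_ball] with z hz
        exact hTn p z hz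
    have hsum : Summable fun p => ∫ z in Metric.ball (0:ℂ) 1, ‖T p z‖ := by
      refine Summable.of_nonneg_of_le (fun p => integral_nonneg fun z => norm_nonneg _)
        (f := fun p : ℕ × ℕ => ‖a p.1‖ * ‖a p.2‖ *
          ∫ z in Metric.ball (0:ℂ) 1, (1 - ‖z‖ ^ 2) ^ (lam - 2)) ?_ ?_
      · intro p
        rw [← integral_const_mul]
        exact setIntegral_mono_on (hTi p).norm (hW.const_mul _) measurableSet_ball (hTn p)
      · exact (ha.mul_of_nonneg ha (fun _ => norm_nonneg _) (fun _ => norm_nonneg _)).mul_right _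
    have key := hasSum_integral_of_summable_integral_norm hTi hsum
    have e1 : ∫ z in Metric.ball (0:ℂ) 1, (∑' p, T p z) =
        ((∫ z in Metric.ball (0 : ℂ) 1, ‖F z‖ ^ 2 * (1 - ‖z‖ ^ 2) ^ (lam - 2) : ℝ) : ℂ) := by
      rw [← integral_complex_ofReal]
      refine setIntegral_congr_fun measurableSet_ball ?_
      intro z hz
      have hs : Summable fun n => ‖a n * z ^ (n + k)‖ :=
        Summable.of_nonneg_of_le (fun _ => norm_nonneg _) (fun n => hb n z hz) ha
      have hs' : Summable fun n => ‖starRingEnd ℂ (a n * z ^ (n + k))‖ := by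
        simpa only [Complex.norm_conj] using hs
      have h1 := tsum_mul_tsum_of_summable_norm hs hs'
      rw [← Complex.conj_tsum, ← hF, Complex.mul_conj, Complex.normSq_eq_norm_sq] at h1
      simp only
      rw [Complex.ofReal_mul, h1, ← tsum_mul_right]
      congr 1
      ext p
      simp only [hT, map_mul, map_pow]
      ring
    rw [e1] at key
    have hd : Function.Injective (fun n : ℕ => (n, n)) := fun x y h => (Prod.mk.inj h).1
    rw [← hd.hasSum_iff] at key
    · have e2 : ((fun p => ∫ z in Metric.ball (0:ℂ) 1, T p z) ∘ fun n : ℕ => (n, n)) =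
          fun n => ((‖a n‖ ^ 2 * (Real.pi * ((n + k).factorial * Real.Gamma (lam - 1) /
        Real.Gamma ((n + k : ℕ) + lam))) : ℝ) : ℂ) := by
        ext n
        simp only [Function.comp, hT]
        rw [integral_const_mul, Complex.mul_conj, Complex.normSq_eq_norm_sq, Complex.ofReal_mul,
          ← aux_rad lam hlam (n + k), ← integral_complex_ofReal]
        congr 2
        ext z
        rw [← mul_pow, Complex.mul_conj, Complex.normSq_eq_norm_sq]
        push_cast
        ring
      rw [e2, Complex.hasSum_ofReal] at key
      exact key.tsum_eq.symm
    · rintro ⟨n, m⟩ hnm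
      have hne : n ≠ m := by
        rintro rfl
        exact hnm ⟨n, rfl⟩
      simp only [hT]
      rw [integral_const_mul, aux_orth _ _ _ (by omega), mul_zero]

/-- For `λ > 1`, `w : ℂ`, `k : ℕ`, with
`F_{w,k}(z) = Σ_n (wⁿ/n!) √(Γ(n+λ)/(n! Γ(λ))) z^{n+k}`, one has
`((λ-1)/π) ∫_𝔻 |F_{w,k}|² (1-|z|²)^{λ-2} dA = I_{k,λ}(|w|²)`; in particular
`F_{w,k} ∈ ℋ_λ` and `c F_{w,k}` has unit norm iff `|c|² I_{k,λ}(|w|²) = 1`. -/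
theorem stmt_4 (lam : ℝ) (hlam : 1 < lam) (w : ℂ) (k : ℕ) (F : ℂ → ℂ)
    (hF : ∀ z : ℂ, F z = ∑' n : ℕ,
      w ^ n / (n.factorial : ℂ) *
        ((Real.sqrt (Real.Gamma ((n : ℝ) + lam) / ((n.factorial : ℝ) * Real.Gamma lam)) : ℝ) : ℂ) *
        z ^ (n + k)) :
    IntegrableOn (fun z : ℂ => ‖F z‖ ^ 2 * (1 - ‖z‖ ^ 2) ^ (lam - 2))
      (Metric.ball (0 : ℂ) 1) volume ∧
    ((lam - 1) / Real.pi) *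
        ∫ z in Metric.ball (0 : ℂ) 1, ‖F z‖ ^ 2 * (1 - ‖z‖ ^ 2) ^ (lam - 2) =
      ∑' n : ℕ, (‖w‖ ^ 2) ^ n / (n.factorial : ℝ) ^ 2 *
        (((n + k).factorial : ℝ) / (n.factorial : ℝ)) *
        (Real.Gamma ((n : ℝ) + lam) / Real.Gamma ((n : ℝ) + (k : ℝ) + lam)) ∧
    ∀ c : ℂ,
      (((lam - 1) / Real.pi) *
          ∫ z in Metric.ball (0 : ℂ) 1, ‖c * F z‖ ^ 2 * (1 - ‖z‖ ^ 2) ^ (lam - 2) = 1 ↔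
        ‖c‖ ^ 2 * ∑' n : ℕ, (‖w‖ ^ 2) ^ n / (n.factorial : ℝ) ^ 2 *
          (((n + k).factorial : ℝ) / (n.factorial : ℝ)) *
          (Real.Gamma ((n : ℝ) + lam) / Real.Gamma ((n : ℝ) + (k : ℝ) + lam)) = 1) := by
  set a : ℕ → ℂ := fun n => w ^ n / (n.factorial : ℂ) *
    ((Real.sqrt (Real.Gamma ((n : ℝ) + lam) / ((n.factorial : ℝ) * Real.Gamma lam)) : ℝ) : ℂ)
    with ha_def
  have hl0 : 0 < lam := by linarith
  have hG := Real.Gamma_pos_of_pos hl0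
  have han : ∀ n, ‖a n‖ = ‖w‖ ^ n / (n.factorial : ℝ) *
      Real.sqrt (Real.Gamma ((n : ℝ) + lam) / ((n.factorial : ℝ) * Real.Gamma lam)) := by
    intro n
    simp only [ha_def]
    rw [norm_mul, norm_div, norm_pow, Complex.norm_natCast, Complex.norm_real,
      Real.norm_of_nonneg (Real.sqrt_nonneg _)]
  have ha : Summable fun n => ‖a n‖ := by
    refine Summable.of_nonneg_of_le (fun _ => norm_nonneg _) ?_
      (Real.summable_pow_div_factorial (‖w‖ * Real.sqrt lam))
    intro n
    rw [han, mul_pow, div_mul_eq_mul_div]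
    gcongr
    rw [Real.sqrt_le_left (by positivity), ← pow_mul, mul_comm n 2, pow_mul, Real.sq_sqrt hl0.le]
    exact aux_coef lam hlam n
  obtain ⟨h1, h2⟩ := aux_main lam hlam k a ha F hF
  have h3 : ((lam - 1) / Real.pi) *
        ∫ z in Metric.ball (0 : ℂ) 1, ‖F z‖ ^ 2 * (1 - ‖z‖ ^ 2) ^ (lam - 2) =
      ∑' n : ℕ, (‖w‖ ^ 2) ^ n / (n.factorial : ℝ) ^ 2 *
        (((n + k).factorial : ℝ) / (n.factorial : ℝ)) *
        (Real.Gamma ((n : ℝ) + lam) / Real.Gamma ((n : ℝ) + (k : ℝ) + lam)) := by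
    rw [h2, ← tsum_mul_left]
    congr 1
    ext n
    have hGn := Real.Gamma_pos_of_pos (show 0 < (n : ℝ) + lam by positivity)
    have hGk := Real.Gamma_pos_of_pos (show 0 < (n : ℝ) + k + lam by positivity)
    have hl1 : lam - 1 ≠ 0 := by linarith
    have hG1 := Real.Gamma_add_one hl1
    have hG1p := Real.Gamma_pos_of_pos (show 0 < lam - 1 by linarith)
    rw [sub_add_cancel] at hG1
    rw [han, mul_pow, Real.sq_sqrt (by positivity), hG1]
    have := Real.pi_pos
    have hf : (0:ℝ) < n.factorial := by positivity
    push_cast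
    field_simp
    exact pow_right_comm _ _ _
  refine ⟨h1, h3, fun c => ?_⟩
  rw [← h3]
  have h4 : ∫ z in Metric.ball (0 : ℂ) 1, ‖c * F z‖ ^ 2 * (1 - ‖z‖ ^ 2) ^ (lam - 2) =
      ‖c‖ ^ 2 * ∫ z in Metric.ball (0 : ℂ) 1, ‖F z‖ ^ 2 * (1 - ‖z‖ ^ 2) ^ (lam - 2) := by
    rw [← integral_const_mul]
    congr 1
    ext z
    rw [norm_mul, mul_pow, mul_assoc]
  rw [h4, mul_left_comm]
end

section
/- Let w ∈ ℂ and k ∈ ℕ. A sequence b : ℕ → ℂ satisfies the recurrence n·b(n) = w·b(n-1) + k·b(n) for all n ≥ 1 together with k·b(0) = 0, if and only if there exists c ∈ ℂ such that b(n) = 0 for all n < k and b(k+m) = c·wᵐ/m! for all m ∈ ℕ. -/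
/-- For `w : ℂ`, `k : ℕ`, a sequence `b : ℕ → ℂ` satisfies
`n b(n) = w b(n-1) + k b(n)` for all `n ≥ 1` together with `k b(0) = 0`
iff there is `c : ℂ` with `b(n) = 0` for `n < k` and `b(k+m) = c wᵐ/m!`. -/
theorem stmt_7 (w : ℂ) (k : ℕ) (b : ℕ → ℂ) :
    ((∀ n : ℕ, 1 ≤ n → (n : ℂ) * b n = w * b (n - 1) + (k : ℂ) * b n) ∧
      (k : ℂ) * b 0 = 0) ↔
    ∃ c : ℂ, (∀ n : ℕ, n < k → b n = 0) ∧
      ∀ m : ℕ, b (k + m) = c * w ^ m / (m.factorial : ℂ) := by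
  constructor
  · rintro ⟨h, h0⟩
    have hz : ∀ n : ℕ, n < k → b n = 0 := by
      intro n
      induction n with
      | zero =>
        intro hn
        have hk : (k : ℂ) ≠ 0 := by exact_mod_cast hn.ne'
        exact (mul_eq_zero.mp h0).resolve_left hk
      | succ n ih =>
        intro hn
        have h1 := h (n + 1) (by omega)
        rw [Nat.add_sub_cancel, ih (by omega)] at h1
        have hk : ((n + 1 : ℕ) : ℂ) - (k : ℂ) ≠ 0 := by
          rw [sub_ne_zero]
          exact_mod_cast hn.ne
        refine (mul_eq_zero.mp ?_).resolve_left hk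
        linear_combination h1
    refine ⟨b k, hz, ?_⟩
    intro m
    induction m with
    | zero => simp
    | succ m ih =>
      have h1 := h (k + (m + 1)) (by omega)
      rw [show k + (m + 1) - 1 = k + m by omega, ih] at h1
      have hm : (m : ℂ) + 1 ≠ 0 := by exact_mod_cast m.succ_ne_zero
      have hf : (m.factorial : ℂ) ≠ 0 := by exact_mod_cast m.factorial_ne_zero
      have h2 : ((m : ℂ) + 1) * b (k + (m + 1)) = w * (b k * w ^ m / (m.factorial : ℂ)) := by
        push_cast at h1
        linear_combination h1
      rw [Nat.factorial_succ]
      push_cast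
      apply mul_left_cancel₀ hm
      rw [h2]
      field_simp
      ring
  · rintro ⟨c, hz, hc⟩
    constructor
    · intro n hn
      rcases lt_trichotomy n k with hlt | rfl | hgt
      · rw [hz n hlt, hz (n - 1) (by omega)]
        simp
      · rw [hz (n - 1) (by omega)]
        simp
      · obtain ⟨m, rfl⟩ : ∃ m, n = k + (m + 1) := ⟨n - k - 1, by omega⟩
        rw [show k + (m + 1) - 1 = k + m by omega, hc, hc, Nat.factorial_succ]
        have hm : (m : ℂ) + 1 ≠ 0 := by exact_mod_cast m.succ_ne_zero
        have hf : (m.factorial : ℂ) ≠ 0 := by exact_mod_cast m.factorial_ne_zero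
        push_cast
        field_simp
        ring
    · rcases Nat.eq_zero_or_pos k with rfl | hk
      · simp
      · rw [hz 0 hk, mul_zero]
end

section
/- Let w ∈ ℂ and k ∈ ℕ, and let f be a holomorphic function on the open unit disc 𝔻. Then f satisfies the differential equation z·f'(z) = w·z·f(z) + k·f(z) for all z ∈ 𝔻 if and only if there exists c ∈ ℂ such that f(z) = c·z^k·e^{wz} for all z ∈ 𝔻. -/
lemma aux_zero (F : ℂ → ℂ) (hF : ContinuousAt F 0)
    (h : ∀ z ∈ Metric.ball (0 : ℂ) 1, z ≠ 0 → F z = 0) : F 0 = 0 := by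
  have h1 : Filter.Tendsto F (nhdsWithin 0 {0}ᶜ) (nhds (F 0)) :=
    hF.tendsto.mono_left nhdsWithin_le_nhds
  have h2 : Filter.Tendsto F (nhdsWithin 0 {0}ᶜ) (nhds 0) := by
    refine tendsto_const_nhds.congr' ?_
    filter_upwards [self_mem_nhdsWithin,
      mem_nhdsWithin_of_mem_nhds (Metric.ball_mem_nhds (0 : ℂ) one_pos)] with z hz hb
    exact (h z hb hz).symm
  exact tendsto_nhds_unique h1 h2

lemma aux_pow (k : ℕ) : ∀ (g : ℂ → ℂ), DifferentiableOn ℂ g (Metric.ball (0 : ℂ) 1) →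
    (∀ z ∈ Metric.ball (0 : ℂ) 1, z ≠ 0 → z * deriv g z = (k : ℂ) * g z) →
    ∃ c : ℂ, ∀ z ∈ Metric.ball (0 : ℂ) 1, g z = c * z ^ k := by
  have h0 : (0 : ℂ) ∈ Metric.ball (0 : ℂ) 1 := by simp
  have hnh : Metric.ball (0 : ℂ) 1 ∈ nhds (0 : ℂ) := Metric.ball_mem_nhds _ one_pos
  induction k with
  | zero =>
    intro g hg h
    have hd : ContinuousAt (deriv g) 0 :=
      ((hg.deriv Metric.isOpen_ball).continuousOn).continuousAt hnh
    have hne : ∀ z ∈ Metric.ball (0 : ℂ) 1, z ≠ 0 → deriv g z = 0 := by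
      intro z hz hz0
      have := h z hz hz0
      simpa [hz0] using this
    have hd0 := aux_zero _ hd hne
    refine ⟨g 0, fun z hz => ?_⟩
    have hc := Metric.isOpen_ball.is_const_of_deriv_eq_zero
      (convex_ball (0 : ℂ) 1).isPreconnected hg
      (fun x hx => by
        by_cases hx0 : x = 0
        · rw [hx0]; exact hd0
        · exact hne x hx hx0) hz h0
    simpa using hc
  | succ k ih =>
    intro g hg h
    have hd : ContinuousAt (deriv g) 0 :=
      ((hg.deriv Metric.isOpen_ball).continuousOn).continuousAt hnh
    have hgc : ContinuousAt g 0 := hg.continuousOn.continuousAt hnh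
    have hg0 : g 0 = 0 := by
      have := aux_zero (fun z => z * deriv g z - ((k + 1 : ℕ) : ℂ) * g z)
        ((continuousAt_id.mul hd).sub (continuousAt_const.mul hgc))
        (fun z hz hz0 => by simp only [h z hz hz0, sub_self])
      have hk : (k : ℂ) + 1 ≠ 0 := by exact_mod_cast Nat.succ_ne_zero k
      simpa [hk] using this
    have hs : DifferentiableOn ℂ (dslope g 0) (Metric.ball (0 : ℂ) 1) :=
      (Complex.differentiableOn_dslope hnh).2 hg
    have hgs : ∀ z, g z = z * dslope g 0 z := by
      intro z
      have := sub_smul_dslope g 0 z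
      simp [hg0] at this
      exact this.symm
    obtain ⟨c, hc⟩ := ih (dslope g 0) hs (by
      intro z hz hz0
      have hda : HasDerivAt (dslope g 0) (deriv (dslope g 0) z) z :=
        (hs.differentiableAt (Metric.isOpen_ball.mem_nhds hz)).hasDerivAt
      have hm := (hasDerivAt_id z).mul hda
      have he : g = id * dslope g 0 := by
        funext x; simpa using hgs x
      have hdg : deriv g z = dslope g 0 z + z * deriv (dslope g 0) z := by
        have := hm.deriv
        rw [← he] at this
        simpa using this
      have e := h z hz hz0
      rw [hdg, hgs z] at e
      push_cast at e
      apply mul_left_cancel₀ hz0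
      linear_combination e)
    refine ⟨c, fun z hz => ?_⟩
    rw [hgs z, hc z hz]
    ring

/-- For `w : ℂ`, `k : ℕ`, and `f` holomorphic on the unit disc `𝔻`,
`z f'(z) = w z f(z) + k f(z)` on `𝔻` iff `f(z) = c z^k e^{wz}` on `𝔻`
for some `c : ℂ` (shifted Barut–Girardello states). -/
theorem stmt_9 (w : ℂ) (k : ℕ) (f : ℂ → ℂ)
    (hf : DifferentiableOn ℂ f (Metric.ball (0 : ℂ) 1)) :
    (∀ z ∈ Metric.ball (0 : ℂ) 1, z * deriv f z = w * z * f z + (k : ℂ) * f z) ↔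
    ∃ c : ℂ, ∀ z ∈ Metric.ball (0 : ℂ) 1, f z = c * z ^ k * Complex.exp (w * z) := by
  have hexp : ∀ (a z : ℂ), HasDerivAt (fun z => Complex.exp (a * z)) (Complex.exp (a * z) * a) z := by
    intro a z
    have := ((hasDerivAt_id z).const_mul a).cexp
    simpa using this
  constructor
  · intro h
    have hder : ∀ z ∈ Metric.ball (0 : ℂ) 1, HasDerivAt (fun z => f z * Complex.exp (-w * z))
        (deriv f z * Complex.exp (-w * z) + f z * (Complex.exp (-w * z) * -w)) z := fun z hz =>
      ((hf.differentiableAt (Metric.isOpen_ball.mem_nhds hz)).hasDerivAt).mul (hexp (-w) z)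
    obtain ⟨c, hc⟩ := aux_pow k (fun z => f z * Complex.exp (-w * z))
      (fun z hz => (hder z hz).differentiableAt.differentiableWithinAt)
      (fun z hz _ => by
        rw [(hder z hz).deriv]
        linear_combination Complex.exp (-w * z) * h z hz)
    refine ⟨c, fun z hz => ?_⟩
    rw [← hc z hz, mul_assoc, ← Complex.exp_add]
    simp
  · rintro ⟨c, hc⟩ z hz
    have he : f =ᶠ[nhds z] fun z => c * z ^ k * Complex.exp (w * z) := by
      filter_upwards [Metric.isOpen_ball.mem_nhds hz] with x hx using hc x hx
    have hd := ((hasDerivAt_pow k z).const_mul c).mul (hexp w z)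
    have hd2 : deriv f z = _ := he.deriv_eq.trans hd.deriv
    rw [hd2, hc z hz]
    cases k with
    | zero => simp; ring
    | succ n => simp only [Nat.add_sub_cancel]; ring
end

section
/- Let w, c ∈ ℂ and k ∈ ℕ, and let b : ℕ → ℂ be the sequence with b(n) = 0 for n < k and b(k+m) = c·wᵐ/m! for m ∈ ℕ, normalized so that Σ_{n=0}^∞ |b(n)|² = 1 (i.e., |c|² Σ_{m=0}^∞ |w|^{2m}/(m!)² = 1). Then Σ_{n=0}^∞ n·|b(n)|² - w·conj( Σ_{n=0}^∞ conj(b(n))·b(n+1) ) = k, all series converging absolutely. -/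
/-- For `w, c : ℂ`, `k : ℕ`, and the normalized sequence `b` with `b(n) = 0`
for `n < k` and `b(k+m) = c wᵐ/m!`, one has the consistency equation
`Σ_n n |b(n)|² - w conj(Σ_n conj(b(n)) b(n+1)) = k`, all series converging
absolutely. -/
theorem stmt_11 (w c : ℂ) (k : ℕ) (b : ℕ → ℂ)
    (hb1 : ∀ n : ℕ, n < k → b n = 0)
    (hb2 : ∀ m : ℕ, b (k + m) = c * w ^ m / (m.factorial : ℂ))
    (hnorm : ∑' n : ℕ, ‖b n‖ ^ 2 = 1) :
    Summable (fun n : ℕ => (n : ℝ) * ‖b n‖ ^ 2) ∧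
    Summable (fun n : ℕ => ‖(starRingEnd ℂ) (b n) * b (n + 1)‖) ∧
    ((∑' n : ℕ, (n : ℝ) * ‖b n‖ ^ 2 : ℝ) : ℂ) -
        w * (starRingEnd ℂ) (∑' n : ℕ, (starRingEnd ℂ) (b n) * b (n + 1)) = (k : ℂ) := by
  have hS : Summable (fun n : ℕ => ‖b n‖ ^ 2) := by
    by_contra h
    rw [tsum_eq_zero_of_not_summable h] at hnorm
    exact zero_ne_one hnorm
  have hS1 : Summable (fun n : ℕ => ‖b (n + 1)‖ ^ 2) :=
    (summable_nat_add_iff (f := fun n : ℕ => ‖b n‖ ^ 2) 1).2 hS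
  have hF : Summable (fun n : ℕ => ‖(starRingEnd ℂ) (b n) * b (n + 1)‖) := by
    refine Summable.of_nonneg_of_le (fun n => norm_nonneg _) (fun n => ?_) (hS.add hS1)
    rw [norm_mul, RCLike.norm_conj]
    nlinarith [sq_nonneg (‖b n‖ - ‖b (n + 1)‖), sq_nonneg (‖b n‖ + ‖b (n + 1)‖)]
  have hrec : ∀ n : ℕ, ((n : ℂ) + 1 - k) * b (n + 1) = w * b n := by
    intro n
    rcases lt_trichotomy (n + 1) k with h | h | h
    · rw [hb1 _ h, hb1 n (by omega)]; simp
    · rw [hb1 n (by omega), ← h]; simp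
    · obtain ⟨m, rfl⟩ : ∃ m, n = k + m := ⟨n - k, by omega⟩
      rw [add_assoc, hb2, hb2, Nat.factorial_succ]
      have h1 : (m.factorial : ℂ) ≠ 0 := by exact_mod_cast m.factorial_ne_zero
      have h2 : (m : ℂ) + 1 ≠ 0 := by exact_mod_cast m.succ_ne_zero
      push_cast
      field_simp
      ring
  have hterm : ∀ n : ℕ, w * (starRingEnd ℂ) ((starRingEnd ℂ) (b n) * b (n + 1)) =
      (((((n + 1 : ℕ) : ℝ) * ‖b (n + 1)‖ ^ 2 - k * ‖b (n + 1)‖ ^ 2 : ℝ)) : ℂ) := by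
    intro n
    have := Complex.mul_conj' (b (n + 1))
    push_cast
    rw [map_mul, Complex.conj_conj, ← mul_assoc, ← hrec, mul_assoc, this]
    ring
  have hG := ((Complex.hasSum_conj'.2 (by simpa using hF.of_norm.hasSum)).mul_left w :
    HasSum (fun n : ℕ => w * (starRingEnd ℂ) ((starRingEnd ℂ) (b n) * b (n + 1)))
      (w * (starRingEnd ℂ) (∑' n : ℕ, (starRingEnd ℂ) (b n) * b (n + 1))))
  simp only [hterm] at hG
  have hD1 : Summable (fun n : ℕ => ((n + 1 : ℕ) : ℝ) * ‖b (n + 1)‖ ^ 2 - k * ‖b (n + 1)‖ ^ 2) :=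
    Complex.summable_ofReal.1 hG.summable
  have hN1 : Summable (fun n : ℕ => ((n + 1 : ℕ) : ℝ) * ‖b (n + 1)‖ ^ 2) := by
    simpa using hD1.add (hS1.mul_left (k : ℝ))
  have hN : Summable (fun n : ℕ => (n : ℝ) * ‖b n‖ ^ 2) :=
    (summable_nat_add_iff (f := fun n : ℕ => (n : ℝ) * ‖b n‖ ^ 2) 1).1 hN1
  refine ⟨hN, hF, ?_⟩
  have h0 : (k : ℝ) * ‖b 0‖ ^ 2 = 0 := by
    rcases Nat.eq_zero_or_pos k with h | h
    · simp [h]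
    · simp [hb1 0 h]
  rw [← hG.tsum_eq, ← Complex.ofReal_tsum, hN1.tsum_sub (hS1.mul_left _), tsum_mul_left,
    hN.tsum_eq_zero_add]
  rw [hS.tsum_eq_zero_add] at hnorm
  have : (∑' n : ℕ, ‖b (n + 1)‖ ^ 2) = 1 - ‖b 0‖ ^ 2 := by linarith
  rw [this, ← Complex.ofReal_sub, ← Complex.ofReal_natCast k]
  congr 1
  push_cast
  linarith
end

section
/- Fix w, z ∈ ℂ and k ∈ ℕ. Then lim_{λ→1⁺} Σ_{n=0}^∞ (wⁿ/n!) · √(Γ(n+λ)/(n!·Γ(λ))) · z^{n+k} = z^k · e^{wz}; that is, as λ → 1⁺ the minimum uncertainty states f_{w,k} of the weighted Bergman space ℋ_λ converge pointwise to the shifted Barut–Girardello states c z^k e^{wz} of the Hardy space. -/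
open Filter

theorem gamma_aux (lam : ℝ) (h1 : 1 < lam) (h2 : lam < 2) (n : ℕ) :
    Real.Gamma ((n : ℝ) + lam) ≤ 4 ^ n * ((n.factorial : ℝ) * Real.Gamma lam) := by
  induction n with
  | zero => simp
  | succ n ih =>
    have hn : (0 : ℝ) ≤ n := Nat.cast_nonneg n
    have e : ((n + 1 : ℕ) : ℝ) + lam = ((n : ℝ) + lam) + 1 := by push_cast; ring
    rw [e, Real.Gamma_add_one (by positivity), Nat.factorial_succ]
    have hG : 0 < Real.Gamma ((n : ℝ) + lam) := Real.Gamma_pos_of_pos (by positivity)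
    calc ((n : ℝ) + lam) * Real.Gamma ((n : ℝ) + lam)
        ≤ (4 * ((n : ℝ) + 1)) * (4 ^ n * ((n.factorial : ℝ) * Real.Gamma lam)) := by
          apply mul_le_mul _ ih hG.le (by positivity)
          linarith
      _ = _ := by push_cast; ring

/-- For fixed `w, z : ℂ`, `k : ℕ`, as `λ → 1⁺`,
`Σ_n (wⁿ/n!) √(Γ(n+λ)/(n! Γ(λ))) z^{n+k} → z^k e^{wz}`; the minimum
uncertainty states of `ℋ_λ` converge pointwise to the shifted
Barut–Girardello states of the Hardy space. -/
theorem stmt_15 (w z : ℂ) (k : ℕ) :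
    Tendsto (fun lam : ℝ => ∑' n : ℕ,
        w ^ n / (n.factorial : ℂ) *
          ((Real.sqrt (Real.Gamma ((n : ℝ) + lam) / ((n.factorial : ℝ) * Real.Gamma lam)) : ℝ) : ℂ) *
          z ^ (n + k))
      (nhdsWithin 1 (Set.Ioi 1))
      (nhds (z ^ k * Complex.exp (w * z))) := by
  have hexp : z ^ k * Complex.exp (w * z)
      = ∑' n : ℕ, w ^ n / (n.factorial : ℂ) * z ^ (n + k) := by
    rw [Complex.exp_eq_exp_ℂ, NormedSpace.exp_eq_tsum_div, ← tsum_mul_left]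
    refine tsum_congr fun n => ?_
    rw [mul_pow, pow_add]; ring
  rw [hexp]
  refine tendsto_tsum_of_dominated_convergence
    (bound := fun n : ℕ => ‖z‖ ^ k * ((2 * ‖w‖ * ‖z‖) ^ n / (n.factorial : ℝ))) ?_ ?_ ?_
  · exact (Real.summable_pow_div_factorial _).mul_left _
  · intro n
    have hc : ContinuousAt (fun lam : ℝ =>
        Real.sqrt (Real.Gamma ((n : ℝ) + lam) / ((n.factorial : ℝ) * Real.Gamma lam))) 1 := by
      have hd : ∀ x : ℝ, 0 < x → ContinuousAt Real.Gamma x := fun x hx =>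
        (Real.differentiableAt_Gamma fun m => by
          have : (0 : ℝ) ≤ m := Nat.cast_nonneg m
          linarith).continuousAt
      apply ContinuousAt.sqrt
      apply ContinuousAt.div
      · exact ContinuousAt.comp (f := fun lam : ℝ => (n : ℝ) + lam) (hd _ (by positivity))
          (by fun_prop)
      · exact continuousAt_const.mul (hd 1 one_pos)
      · simp [Real.Gamma_one, Nat.factorial_ne_zero]
    have ht := (hc.tendsto).mono_left (nhdsWithin_le_nhds (s := Set.Ioi 1))
    have hv : Real.sqrt (Real.Gamma ((n : ℝ) + 1) / ((n.factorial : ℝ) * Real.Gamma 1)) = 1 := by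
      rw [Real.Gamma_nat_eq_factorial, Real.Gamma_one, mul_one,
        div_self (by exact_mod_cast Nat.factorial_ne_zero n), Real.sqrt_one]
    rw [hv] at ht
    have ht2 := (Complex.continuous_ofReal.tendsto 1).comp ht
    have := (ht2.const_mul (w ^ n / (n.factorial : ℂ))).mul_const (z ^ (n + k))
    simpa using this
  · filter_upwards [Ioo_mem_nhdsGT (show (1 : ℝ) < 2 by norm_num)] with lam hl n
    have hG : 0 < Real.Gamma lam := Real.Gamma_pos_of_pos (by linarith [hl.1])
    have hs : Real.sqrt (Real.Gamma ((n : ℝ) + lam) / ((n.factorial : ℝ) * Real.Gamma lam))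
        ≤ 2 ^ n := by
      apply Real.sqrt_le_iff.2 ⟨by positivity, ?_⟩
      rw [div_le_iff₀ (by positivity), ← pow_mul, mul_comm n 2, pow_mul]
      norm_num only
      exact gamma_aux lam hl.1 hl.2 n
    rw [norm_mul, norm_mul, norm_div, norm_pow, norm_pow, Complex.norm_real,
      Real.norm_of_nonneg (Real.sqrt_nonneg _), Complex.norm_natCast]
    calc _ ≤ ‖w‖ ^ n / (n.factorial : ℝ) * 2 ^ n * ‖z‖ ^ (n + k) := by gcongr
      _ = _ := by rw [mul_pow, mul_pow, pow_add]; ring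
end
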